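/- arXiv:2106.03783 — 6 statements merged into one kernel-verified Lean document; each statement's English description precedes it below -/
import Mathlib

section
/- For any conditional model q(y|x), with α := min{P(t=0), P(t=1)}, the sum of the train and test errors is lower-bounded by the concept shift: D_KL(p^{t=1}_{y|x} || q_{y|x}) + D_KL(p^{t=0}_{y|x} || q_{y|x}) ≥ (1/(1−α)) · I(y;t|x). -/
open Finset Real

noncomputable section

namespace Stmt0

variable {X Y : Type*} [Fintype X] [Fintype Y]

/-- Marginal probability of the selection `t`: `P(t)`. -/
def pT (p : X → Y → Bool → ℝ) (t : Bool) : ℝ := ∑ x, ∑ y, p x y t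

/-- Marginal probability of `x`: `p(x)`. -/
def pX (p : X → Y → Bool → ℝ) (x : X) : ℝ := ∑ y, ∑ t, p x y t

/-- Joint probability of `(x, t)`: `p(x, t)`. -/
def pXt (p : X → Y → Bool → ℝ) (x : X) (t : Bool) : ℝ := ∑ y, p x y t

/-- Joint probability of `(x, y)`: `p(x, y)`. -/
def pXY (p : X → Y → Bool → ℝ) (x : X) (y : Y) : ℝ := ∑ t, p x y t

/-- `D_KL(p^{t=i}_{y|x} ‖ q_{y|x}) = Σ_{x,y} p(x,y|t=i) log (p(y|x,t=i) / q(y|x))`. -/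
def condErr (p : X → Y → Bool → ℝ) (q : X → Y → ℝ) (t : Bool) : ℝ :=
  ∑ x, ∑ y, (p x y t / pT p t) * Real.log ((p x y t / pXt p x t) / q x y)

/-- Concept shift `I(y;t|x) = Σ_{x,y,t} p(x,y,t) log (p(y,t|x) / (p(y|x) p(t|x)))`. -/
def conceptShift (p : X → Y → Bool → ℝ) : ℝ :=
  ∑ x, ∑ y, ∑ t, p x y t *
    Real.log ((p x y t / pX p x) / ((pXY p x y / pX p x) * (pXt p x t / pX p x)))

theorem gibbs_aux {Y : Type*} [Fintype Y] (a q : Y → ℝ) (ha : ∀ y, 0 < a y) (hq : ∀ y, 0 < q y)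
    (hs : ∑ y, q y = 1) : 0 ≤ ∑ y, a y * Real.log ((a y / ∑ z, a z) / q y) := by
  have hS : ∀ y, 0 < ∑ z, a z := fun y => Finset.sum_pos (fun z _ => ha z) ⟨y, Finset.mem_univ y⟩
  have h : ∑ y, (a y - (∑ z, a z) * q y) ≤ ∑ y, a y * Real.log ((a y / ∑ z, a z) / q y) := by
    apply Finset.sum_le_sum
    intro y _
    have h1 := hS y
    have h2 := ha y
    have h3 := hq y
    have h4 := Real.one_sub_inv_le_log_of_pos (x := (a y / ∑ z, a z) / q y) (by positivity)
    have h5 := mul_le_mul_of_nonneg_left h4 h2.le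
    refine le_trans (le_of_eq ?_) h5
    field_simp
  rw [Finset.sum_sub_distrib, ← Finset.mul_sum, hs] at h
  linarith

/-- For any conditional model `q(y|x)`, with `α = min {P(t=0), P(t=1)}`, the sum of the train
and test errors is lower-bounded by `(1/(1-α)) ⬝ I(y;t|x)`. -/
theorem train_plus_test_error_ge_concept_shift
    (p : X → Y → Bool → ℝ) (q : X → Y → ℝ)
    (hp : ∀ x y t, 0 < p x y t)
    (hpsum : ∑ x, ∑ y, ∑ t, p x y t = 1)
    (hq : ∀ x y, 0 < q x y) (hqsum : ∀ x, ∑ y, q x y = 1)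
    (ht0 : 0 < pT p true) (ht1 : pT p true < 1) :
    condErr p q true + condErr p q false ≥
      (1 / (1 - min (pT p false) (pT p true))) * conceptShift p := by
  have hYne : ∀ x : X, Nonempty Y := by
    intro x
    by_contra hn
    rw [not_nonempty_iff] at hn
    have := hqsum x
    simp at this
  have hXt : ∀ x t, 0 < pXt p x t := by
    intro x t
    haveI := hYne x
    exact Finset.sum_pos (fun y _ => hp x y t) Finset.univ_nonempty
  have hXY : ∀ x y, 0 < pXY p x y := by
    intro x y
    exact Finset.sum_pos (fun t _ => hp x y t) Finset.univ_nonempty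
  have hX : ∀ x, 0 < pX p x := by
    intro x
    haveI := hYne x
    exact Finset.sum_pos (fun y _ => hXY x y) Finset.univ_nonempty
  have hT : pT p true + pT p false = 1 := by
    rw [← hpsum]
    simp [pT, Finset.sum_add_distrib]
  set A : Bool → ℝ := fun t => ∑ x, ∑ y, p x y t * Real.log ((p x y t / pXt p x t) / q x y) with hA
  have hA0 : ∀ t, 0 ≤ A t := fun t => Finset.sum_nonneg fun x _ =>
    gibbs_aux (fun y => p x y t) (q x) (fun y => hp x y t) (hq x) (hqsum x)
  have hD : ∀ t, condErr p q t = A t / pT p t := by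
    intro t
    simp only [condErr, hA, Finset.sum_div]
    refine Finset.sum_congr rfl fun x _ => Finset.sum_congr rfl fun y _ => ?_
    ring
  have hB : 0 ≤ ∑ x, ∑ y, pXY p x y * Real.log ((pXY p x y / pX p x) / q x y) :=
    Finset.sum_nonneg fun x _ => gibbs_aux (pXY p x) (q x) (hXY x) (hq x) (hqsum x)
  have hC : A true + A false = conceptShift p +
      ∑ x, ∑ y, pXY p x y * Real.log ((pXY p x y / pX p x) / q x y) := by
    simp only [hA, conceptShift, ← Finset.sum_add_distrib]
    refine Finset.sum_congr rfl fun x _ => Finset.sum_congr rfl fun y _ => ?_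
    have key : ∀ t, Real.log ((p x y t / pXt p x t) / q x y) =
        Real.log ((p x y t / pX p x) / ((pXY p x y / pX p x) * (pXt p x t / pX p x))) +
        Real.log ((pXY p x y / pX p x) / q x y) := by
      intro t
      have h1 := hp x y t
      have h2 := hXt x t
      have h3 := hXY x y
      have h4 := hX x
      have h5 := hq x y
      rw [← Real.log_mul (by positivity) (by positivity)]
      congr 1
      field_simp
    have hs : pXY p x y = p x y true + p x y false := by simp [pXY]
    rw [key true, key false, Fintype.sum_bool]
    generalize Real.log ((pXY p x y / pX p x) / q x y) = L
    rw [hs]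
    ring
  have hM0 : 0 < 1 - min (pT p false) (pT p true) := by
    have := min_le_right (pT p false) (pT p true)
    linarith
  have h1 : pT p true ≤ 1 - min (pT p false) (pT p true) := by
    have := min_le_left (pT p false) (pT p true)
    linarith
  have h0 : pT p false ≤ 1 - min (pT p false) (pT p true) := by
    have := min_le_right (pT p false) (pT p true)
    linarith
  have hf : 0 < pT p false := by linarith
  rw [hD, hD, ge_iff_le, one_div_mul_eq_div]
  have e1 := div_le_div_of_nonneg_left (hA0 true) ht0 h1
  have e2 := div_le_div_of_nonneg_left (hA0 false) hf h0
  have e3 : conceptShift p / (1 - min (pT p false) (pT p true)) ≤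
      (A true + A false) / (1 - min (pT p false) (pT p true)) :=
    div_le_div_of_nonneg_right (by linarith) hM0.le
  rw [add_div] at e3
  linarith

end Stmt0
end
end

section
/- For any encoder q(z|x) and classifier q(y|z) with induced model q(y|x) = Σ_z q(z|x) q(y|z), the train and test errors are bounded by information loss plus latent error: D_KL(p^{t=1}_{y|x} || q_{y|x}) ≤ I_{t=1}(x;y|z) + D_KL(p^{t=1}_{y|z} || q_{y|z}) and D_KL(p^{t=0}_{y|x} || q_{y|x}) ≤ I_{t=0}(x;y|z) + D_KL(p^{t=0}_{y|z} || q_{y|z}). -/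
open Finset Real

noncomputable section

namespace Stmt5

variable {X Y Z : Type*} [Fintype X] [Fintype Y] [Fintype Z]

/-- Marginal probability of the selection `t`: `P(t)`. -/
def pT (p : X → Y → Bool → ℝ) (t : Bool) : ℝ := ∑ x, ∑ y, p x y t

/-- Joint probability of `(x, t)`: `p(x, t)`. -/
def pXt (p : X → Y → Bool → ℝ) (x : X) (t : Bool) : ℝ := ∑ y, p x y t

/-- The induced model `q(y|x) = Σ_z q(z|x) q(y|z)`. -/
def induced (enc : X → Z → ℝ) (cls : Z → Y → ℝ) (x : X) (y : Y) : ℝ :=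
  ∑ z, enc x z * cls z y

/-- `D_KL(p^{t=i}_{y|x} ‖ q_{y|x}) = Σ_{x,y} p(x,y|t=i) log (p(y|x,t=i) / q(y|x))`. -/
def condErr (p : X → Y → Bool → ℝ) (q : X → Y → ℝ) (t : Bool) : ℝ :=
  ∑ x, ∑ y, (p x y t / pT p t) * Real.log ((p x y t / pXt p x t) / q x y)

/-- Joint law of `(x, y, z)` given `t`, where `z` is drawn from the encoder `q(z|x)`
conditionally independent of `(y, t)` given `x`: `p(x,y,z|t) = p(x,y|t) q(z|x)`. -/
def r (p : X → Y → Bool → ℝ) (enc : X → Z → ℝ) (t : Bool) (x : X) (y : Y) (z : Z) : ℝ :=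
  (p x y t / pT p t) * enc x z

/-- `p(z|t)`. -/
def rZ (p : X → Y → Bool → ℝ) (enc : X → Z → ℝ) (t : Bool) (z : Z) : ℝ :=
  ∑ x, ∑ y, r p enc t x y z

/-- `p(x,z|t)`. -/
def rXZ (p : X → Y → Bool → ℝ) (enc : X → Z → ℝ) (t : Bool) (x : X) (z : Z) : ℝ :=
  ∑ y, r p enc t x y z

/-- `p(y,z|t)`. -/
def rYZ (p : X → Y → Bool → ℝ) (enc : X → Z → ℝ) (t : Bool) (y : Y) (z : Z) : ℝ :=
  ∑ x, r p enc t x y z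

/-- Information loss
`I_{t=i}(x;y|z) = Σ_{x,y,z} p(x,y,z|t=i) log (p(x,y|z,t=i) / (p(x|z,t=i) p(y|z,t=i)))`. -/
def infoLoss (p : X → Y → Bool → ℝ) (enc : X → Z → ℝ) (t : Bool) : ℝ :=
  ∑ x, ∑ y, ∑ z, r p enc t x y z *
    Real.log ((r p enc t x y z / rZ p enc t z) /
      ((rXZ p enc t x z / rZ p enc t z) * (rYZ p enc t y z / rZ p enc t z)))

/-- Latent error `D_KL(p^{t=i}_{y|z} ‖ q_{y|z})`. -/
def latentErr (p : X → Y → Bool → ℝ) (enc : X → Z → ℝ) (cls : Z → Y → ℝ) (t : Bool) : ℝ :=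
  ∑ z, ∑ y, rYZ p enc t y z * Real.log ((rYZ p enc t y z / rZ p enc t z) / cls z y)

theorem aux (p : X → Y → Bool → ℝ) (enc : X → Z → ℝ) (cls : Z → Y → ℝ)
    (hp : ∀ x y t, 0 < p x y t)
    (henc : ∀ x z, 0 < enc x z) (hencsum : ∀ x, ∑ z, enc x z = 1)
    (hcls : ∀ z y, 0 < cls z y) (t : Bool) :
    condErr p (induced enc cls) t ≤ infoLoss p enc t + latentErr p enc cls t := by
  have hlat : latentErr p enc cls t = ∑ x, ∑ y, ∑ z, r p enc t x y z *
      Real.log ((rYZ p enc t y z / rZ p enc t z) / cls z y) := by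
    unfold latentErr
    have h1 : ∀ z y, rYZ p enc t y z * Real.log ((rYZ p enc t y z / rZ p enc t z) / cls z y)
        = ∑ x, r p enc t x y z * Real.log ((rYZ p enc t y z / rZ p enc t z) / cls z y) := by
      intro z y
      rw [← Finset.sum_mul]
      rfl
    simp only [h1]
    rw [Finset.sum_comm]
    rw [Finset.sum_congr rfl (fun y _ => Finset.sum_comm)]
    rw [Finset.sum_comm]
  rw [hlat]
  unfold condErr infoLoss
  simp only [← Finset.sum_add_distrib]
  refine Finset.sum_le_sum fun x _ => Finset.sum_le_sum fun y _ => ?_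
  have hne : (Finset.univ : Finset X).Nonempty := ⟨x, Finset.mem_univ x⟩
  have hney : (Finset.univ : Finset Y).Nonempty := ⟨y, Finset.mem_univ y⟩
  have hT : 0 < pT p t := Finset.sum_pos (fun x _ => Finset.sum_pos (fun y _ => hp x y t) hney) hne
  have hXt : 0 < pXt p x t := Finset.sum_pos (fun y _ => hp x y t) hney
  have hr : ∀ x y z, 0 < r p enc t x y z := fun x y z =>
    mul_pos (div_pos (hp x y t) hT) (henc x z)
  have hZ : ∀ z, 0 < rZ p enc t z := fun z =>
    Finset.sum_pos (fun x _ => Finset.sum_pos (fun y _ => hr x y z) hney) hne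
  have hYZ : ∀ z, 0 < rYZ p enc t y z := fun z => Finset.sum_pos (fun x _ => hr x y z) hne
  have hXZ : ∀ z, rXZ p enc t x z = pXt p x t / pT p t * enc x z := by
    intro z
    unfold rXZ r pXt
    rw [← Finset.sum_mul, ← Finset.sum_div]
  have hP : 0 < p x y t := hp x y t
  have hterm : ∀ z, r p enc t x y z *
      Real.log ((r p enc t x y z / rZ p enc t z) /
        ((rXZ p enc t x z / rZ p enc t z) * (rYZ p enc t y z / rZ p enc t z))) +
      r p enc t x y z * Real.log ((rYZ p enc t y z / rZ p enc t z) / cls z y)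
      = (p x y t / pT p t) * (enc x z * Real.log (p x y t / pXt p x t)
          - enc x z * Real.log (cls z y)) := by
    intro z
    have a1 := hZ z
    have a2 := hYZ z
    have a3 := henc x z
    have a4 := hcls z y
    have e : ((r p enc t x y z / rZ p enc t z) /
        ((rXZ p enc t x z / rZ p enc t z) * (rYZ p enc t y z / rZ p enc t z))) *
        ((rYZ p enc t y z / rZ p enc t z) / cls z y) = (p x y t / pXt p x t) / cls z y := by
      rw [hXZ]
      unfold r
      field_simp
    have b := hr x y z
    have c : 0 < rXZ p enc t x z := by rw [hXZ]; positivity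
    rw [← mul_add, ← Real.log_mul (by positivity) (by positivity), e,
      Real.log_div (by positivity) (by positivity)]
    unfold r
    ring
  rw [Finset.sum_congr rfl (fun z _ => hterm z), ← Finset.mul_sum, Finset.sum_sub_distrib,
    ← Finset.sum_mul, hencsum, one_mul]
  refine mul_le_mul_of_nonneg_left ?_ (div_pos hP hT).le
  have hnez : (Finset.univ : Finset Z).Nonempty := by
    by_contra h
    have := hencsum x
    rw [Finset.not_nonempty_iff_eq_empty.mp h] at this
    simp at this
  have hind : 0 < induced enc cls x y :=
    Finset.sum_pos (fun z _ => mul_pos (henc x z) (hcls z y)) hnez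
  rw [Real.log_div (div_pos hP hXt).ne' hind.ne']
  have hJ := strictConcaveOn_log_Ioi.concaveOn.le_map_sum (t := (Finset.univ : Finset Z))
    (w := fun z => enc x z) (p := fun z => cls z y) (fun z _ => (henc x z).le) (hencsum x)
    (fun z _ => hcls z y)
  simp only [smul_eq_mul] at hJ
  unfold induced
  linarith

/-- Train and test errors are bounded by information loss plus latent error:
`D_KL(p^{t=i}_{y|x} ‖ q_{y|x}) ≤ I_{t=i}(x;y|z) + D_KL(p^{t=i}_{y|z} ‖ q_{y|z})`
for `i = 1` (train) and `i = 0` (test). -/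
theorem error_le_infoLoss_add_latentErr
    (p : X → Y → Bool → ℝ) (enc : X → Z → ℝ) (cls : Z → Y → ℝ)
    (hp : ∀ x y t, 0 < p x y t)
    (hpsum : ∑ x, ∑ y, ∑ t, p x y t = 1)
    (henc : ∀ x z, 0 < enc x z) (hencsum : ∀ x, ∑ z, enc x z = 1)
    (hcls : ∀ z y, 0 < cls z y) (hclssum : ∀ z, ∑ y, cls z y = 1)
    (ht0 : 0 < pT p true) (ht1 : pT p true < 1) :
    condErr p (induced enc cls) true ≤ infoLoss p enc true + latentErr p enc cls true ∧
    condErr p (induced enc cls) false ≤ infoLoss p enc false + latentErr p enc cls false := by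
  exact ⟨aux p enc cls hp henc hencsum hcls true, aux p enc cls hp henc hencsum hcls false⟩

end Stmt5

end
end

section
/- (Sufficiency criterion.) If the selection t is conditionally independent of the pair (y,z) given the environmental factors e (i.e., p(t|e) = p(t|e,z) = p(t|e,z,y), as holds when t = f(e,ε) for a function f and noise ε independent of everything else), then the latent concept shift is upper-bounded by the sufficiency regularizer: I(y;t|z) ≤ I(y;e|z). -/
open Finset Real

noncomputable section

namespace Stmt11

variable {Y Z E : Type*} [Fintype Y] [Fintype Z] [Fintype E]

/-- `P(t)`. -/
def pT (p : Y → Z → E → Bool → ℝ) (t : Bool) : ℝ := ∑ y, ∑ z, ∑ e, p y z e t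
/-- `p(e)`. -/
def pE (p : Y → Z → E → Bool → ℝ) (e : E) : ℝ := ∑ y, ∑ z, ∑ t, p y z e t
/-- `p(e, t)`. -/
def pEt (p : Y → Z → E → Bool → ℝ) (e : E) (t : Bool) : ℝ := ∑ y, ∑ z, p y z e t
/-- `p(z, e)`. -/
def pZE (p : Y → Z → E → Bool → ℝ) (z : Z) (e : E) : ℝ := ∑ y, ∑ t, p y z e t
/-- `p(z, e, t)`. -/
def pZEt (p : Y → Z → E → Bool → ℝ) (z : Z) (e : E) (t : Bool) : ℝ := ∑ y, p y z e t
/-- `p(y, z, e)`. -/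
def pYZE (p : Y → Z → E → Bool → ℝ) (y : Y) (z : Z) (e : E) : ℝ := ∑ t, p y z e t
/-- `p(z)`. -/
def pZ (p : Y → Z → E → Bool → ℝ) (z : Z) : ℝ := ∑ y, ∑ e, ∑ t, p y z e t
/-- `p(z, t)`. -/
def pZt (p : Y → Z → E → Bool → ℝ) (z : Z) (t : Bool) : ℝ := ∑ y, ∑ e, p y z e t
/-- `p(y, z)`. -/
def pYZ (p : Y → Z → E → Bool → ℝ) (y : Y) (z : Z) : ℝ := ∑ e, ∑ t, p y z e t
/-- `p(y, z, t)`. -/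
def pYZt (p : Y → Z → E → Bool → ℝ) (y : Y) (z : Z) (t : Bool) : ℝ := ∑ e, p y z e t

/-- Latent concept shift `I(y;t|z)`. -/
def IytZ (p : Y → Z → E → Bool → ℝ) : ℝ :=
  ∑ y, ∑ z, ∑ t, pYZt p y z t *
    Real.log ((pYZt p y z t / pZ p z) / ((pYZ p y z / pZ p z) * (pZt p z t / pZ p z)))

/-- Sufficiency regularizer `I(y;e|z)`. -/
def IyeZ (p : Y → Z → E → Bool → ℝ) : ℝ :=
  ∑ y, ∑ z, ∑ e, pYZE p y z e *
    Real.log ((pYZE p y z e / pZ p z) / ((pYZ p y z / pZ p z) * (pZE p z e / pZ p z)))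

/-- Sufficiency criterion: if the selection `t` is conditionally independent of `(y, z)`
given the environmental factors `e` (i.e. `p(t|e) = p(t|e,z) = p(t|e,z,y)`), then the
latent concept shift is upper-bounded by the sufficiency regularizer:
`I(y;t|z) ≤ I(y;e|z)`. -/
theorem sufficiency_bound
    (p : Y → Z → E → Bool → ℝ)
    (hp : ∀ y z e t, 0 < p y z e t)
    (hpsum : ∑ y, ∑ z, ∑ e, ∑ t, p y z e t = 1)
    (ht0 : 0 < pT p true) (ht1 : pT p true < 1)
    (hci₁ : ∀ z e t, pZEt p z e t / pZE p z e = pEt p e t / pE p e)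
    (hci₂ : ∀ y z e t, p y z e t / pYZE p y z e = pEt p e t / pE p e) :
    IytZ p ≤ IyeZ p := by
  have hY : Nonempty Y := by
    by_contra h
    rw [not_nonempty_iff] at h
    simp at hpsum
  have hE : Nonempty E := by
    by_contra h
    rw [not_nonempty_iff] at h
    simp at hpsum
  have h1 : ∀ y z t, 0 < pYZt p y z t := fun y z t =>
    Finset.sum_pos (fun e _ => hp y z e t) Finset.univ_nonempty
  have h2 : ∀ y z e, 0 < pYZE p y z e := fun y z e =>
    Finset.sum_pos (fun t _ => hp y z e t) Finset.univ_nonempty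
  have h3 : ∀ z t, 0 < pZt p z t := fun z t =>
    Finset.sum_pos (fun y _ => h1 y z t) Finset.univ_nonempty
  have h4 : ∀ z e, 0 < pZE p z e := fun z e =>
    Finset.sum_pos (fun y _ => h2 y z e) Finset.univ_nonempty
  have h5 : ∀ y z, 0 < pYZ p y z := fun y z =>
    Finset.sum_pos (fun e _ => h2 y z e) Finset.univ_nonempty
  have h6 : ∀ z, 0 < pZ p z := fun z =>
    Finset.sum_pos (fun y _ => h5 y z) Finset.univ_nonempty
  unfold IytZ IyeZ
  refine Finset.sum_le_sum fun y _ => Finset.sum_le_sum fun z _ => ?_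
  set A : Bool → ℝ := fun t =>
    (pYZt p y z t / pZ p z) / ((pYZ p y z / pZ p z) * (pZt p z t / pZ p z)) with hA
  set B : E → ℝ := fun e =>
    (pYZE p y z e / pZ p z) / ((pYZ p y z / pZ p z) * (pZE p z e / pZ p z)) with hB
  have key : ∀ t e, p y z e t * Real.log (A t) ≤
      p y z e t * Real.log (B e) + (pYZt p y z t / pZt p z t * pZEt p z e t - p y z e t) := by
    intro t e
    have a1 := h1 y z t
    have a2 := h2 y z e
    have a3 := h3 z t
    have a4 := h4 z e
    have a5 := h5 y z
    have a6 := h6 z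
    have hAp : 0 < A t := by simp only [hA]; positivity
    have hBp : 0 < B e := by simp only [hB]; positivity
    have hl := Real.log_le_sub_one_of_pos (div_pos hAp hBp)
    rw [Real.log_div hAp.ne' hBp.ne'] at hl
    have hm := mul_le_mul_of_nonneg_left hl (hp y z e t).le
    have hq : p y z e t * pZE p z e = pZEt p z e t * pYZE p y z e := by
      have := (hci₂ y z e t).trans (hci₁ z e t).symm
      rwa [div_eq_div_iff a2.ne' a4.ne'] at this
    have hr : p y z e t * (A t / B e) = pYZt p y z t / pZt p z t * pZEt p z e t := by
      have hAB : A t / B e = pYZt p y z t * pZE p z e / (pZt p z t * pYZE p y z e) := by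
        simp only [hA, hB]
        field_simp
      rw [hAB]
      field_simp
      linear_combination hq
    rw [mul_sub, mul_sub, hr] at hm
    linarith
  have hs : ∀ t, ∑ e, pZEt p z e t = pZt p z t := fun t => Finset.sum_comm
  calc ∑ t, pYZt p y z t * Real.log (A t)
      = ∑ t, ∑ e, p y z e t * Real.log (A t) := by
        refine Finset.sum_congr rfl fun t _ => ?_
        rw [pYZt, Finset.sum_mul]
    _ ≤ ∑ t, ∑ e, (p y z e t * Real.log (B e) +
          (pYZt p y z t / pZt p z t * pZEt p z e t - p y z e t)) :=
        Finset.sum_le_sum fun t _ => Finset.sum_le_sum fun e _ => key t e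
    _ = ∑ t, ∑ e, p y z e t * Real.log (B e) := by
        refine Finset.sum_congr rfl fun t _ => ?_
        rw [Finset.sum_add_distrib, Finset.sum_sub_distrib, ← Finset.mul_sum, hs,
          div_mul_cancel₀ _ (h3 z t).ne']
        simp [pYZt]
    _ = ∑ e, pYZE p y z e * Real.log (B e) := by
        rw [Finset.sum_comm]
        refine Finset.sum_congr rfl fun e _ => ?_
        rw [pYZE, Finset.sum_mul]


end Stmt11

end
end

section
/- (Separation criterion.) If the selection t is conditionally independent of z given the pair (e,y) (i.e., p(t|e,y) = p(t|e,y,z), as holds when t = f(e,y,ε) for a function f and noise ε independent of everything else), then the latent concept shift is upper-bounded by the sum of the prior shift and the separation regularizer: I(y;t|z) ≤ I(y;t) + I(e;z|y). -/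
open Finset Real

noncomputable section

namespace Stmt12

variable {Y Z E : Type*} [Fintype Y] [Fintype Z] [Fintype E]

/-- `P(t)`. -/
def pT (p : Y → Z → E → Bool → ℝ) (t : Bool) : ℝ := ∑ y, ∑ z, ∑ e, p y z e t
/-- `p(y)`. -/
def pY (p : Y → Z → E → Bool → ℝ) (y : Y) : ℝ := ∑ z, ∑ e, ∑ t, p y z e t
/-- `p(y, t)`. -/
def pYt (p : Y → Z → E → Bool → ℝ) (y : Y) (t : Bool) : ℝ := ∑ z, ∑ e, p y z e t
/-- `p(y, e)`. -/
def pYE (p : Y → Z → E → Bool → ℝ) (y : Y) (e : E) : ℝ := ∑ z, ∑ t, p y z e t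
/-- `p(y, e, t)`. -/
def pYEt (p : Y → Z → E → Bool → ℝ) (y : Y) (e : E) (t : Bool) : ℝ := ∑ z, p y z e t
/-- `p(y, z, e)`. -/
def pYZE (p : Y → Z → E → Bool → ℝ) (y : Y) (z : Z) (e : E) : ℝ := ∑ t, p y z e t
/-- `p(z)`. -/
def pZ (p : Y → Z → E → Bool → ℝ) (z : Z) : ℝ := ∑ y, ∑ e, ∑ t, p y z e t
/-- `p(z, t)`. -/
def pZt (p : Y → Z → E → Bool → ℝ) (z : Z) (t : Bool) : ℝ := ∑ y, ∑ e, p y z e t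
/-- `p(y, z)`. -/
def pYZ (p : Y → Z → E → Bool → ℝ) (y : Y) (z : Z) : ℝ := ∑ e, ∑ t, p y z e t
/-- `p(y, z, t)`. -/
def pYZt (p : Y → Z → E → Bool → ℝ) (y : Y) (z : Z) (t : Bool) : ℝ := ∑ e, p y z e t

/-- Latent concept shift `I(y;t|z)`. -/
def IytZ (p : Y → Z → E → Bool → ℝ) : ℝ :=
  ∑ y, ∑ z, ∑ t, pYZt p y z t *
    Real.log ((pYZt p y z t / pZ p z) / ((pYZ p y z / pZ p z) * (pZt p z t / pZ p z)))

/-- Prior shift `I(y;t)`. -/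
def Iyt (p : Y → Z → E → Bool → ℝ) : ℝ :=
  ∑ y, ∑ t, pYt p y t * Real.log (pYt p y t / (pY p y * pT p t))

/-- Separation regularizer `I(e;z|y)`. -/
def IezY (p : Y → Z → E → Bool → ℝ) : ℝ :=
  ∑ y, ∑ z, ∑ e, pYZE p y z e *
    Real.log ((pYZE p y z e / pY p y) / ((pYE p y e / pY p y) * (pYZ p y z / pY p y)))

/-- Separation criterion: if the selection `t` is conditionally independent of `z` given
`(e, y)` (i.e. `p(t|e,y) = p(t|e,y,z)`), then the latent concept shift is upper-bounded by
the prior shift plus the separation regularizer: `I(y;t|z) ≤ I(y;t) + I(e;z|y)`. -/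
theorem separation_bound
    (p : Y → Z → E → Bool → ℝ)
    (hp : ∀ y z e t, 0 < p y z e t)
    (hpsum : ∑ y, ∑ z, ∑ e, ∑ t, p y z e t = 1)
    (ht0 : 0 < pT p true) (ht1 : pT p true < 1)
    (hci : ∀ y z e t, p y z e t / pYZE p y z e = pYEt p y e t / pYE p y e) :
    IytZ p ≤ Iyt p + IezY p := by
  have hmain : ∀ y z e t,
      p y z e t * Real.log ((pYZt p y z t / pZ p z) /
        ((pYZ p y z / pZ p z) * (pZt p z t / pZ p z)))
      - p y z e t * Real.log (pYt p y t / (pY p y * pT p t))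
      - p y z e t * Real.log ((pYZE p y z e / pY p y) /
        ((pYE p y e / pY p y) * (pYZ p y z / pY p y)))
      ≤ pYEt p y e t * (pYZt p y z t / pYt p y t * (pT p t * pZ p z / pZt p z t))
        - p y z e t := by
    intro y z e t
    haveI : Nonempty Y := ⟨y⟩
    haveI : Nonempty Z := ⟨z⟩
    haveI : Nonempty E := ⟨e⟩
    have h0 := hp y z e t
    have h1 : 0 < pT p t := Finset.sum_pos (fun _ _ => Finset.sum_pos (fun _ _ => Finset.sum_pos (fun _ _ => hp _ _ _ _) Finset.univ_nonempty) Finset.univ_nonempty) Finset.univ_nonempty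
    have h2 : 0 < pY p y := Finset.sum_pos (fun _ _ => Finset.sum_pos (fun _ _ => Finset.sum_pos (fun _ _ => hp _ _ _ _) Finset.univ_nonempty) Finset.univ_nonempty) Finset.univ_nonempty
    have h3 : 0 < pYt p y t := Finset.sum_pos (fun _ _ => Finset.sum_pos (fun _ _ => hp _ _ _ _) Finset.univ_nonempty) Finset.univ_nonempty
    have h4 : 0 < pYE p y e := Finset.sum_pos (fun _ _ => Finset.sum_pos (fun _ _ => hp _ _ _ _) Finset.univ_nonempty) Finset.univ_nonempty
    have h5 : 0 < pYEt p y e t := Finset.sum_pos (fun _ _ => hp _ _ _ _) Finset.univ_nonempty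
    have h6 : 0 < pYZE p y z e := Finset.sum_pos (fun _ _ => hp _ _ _ _) Finset.univ_nonempty
    have h7 : 0 < pZ p z := Finset.sum_pos (fun _ _ => Finset.sum_pos (fun _ _ => Finset.sum_pos (fun _ _ => hp _ _ _ _) Finset.univ_nonempty) Finset.univ_nonempty) Finset.univ_nonempty
    have h8 : 0 < pZt p z t := Finset.sum_pos (fun _ _ => Finset.sum_pos (fun _ _ => hp _ _ _ _) Finset.univ_nonempty) Finset.univ_nonempty
    have h9 : 0 < pYZ p y z := Finset.sum_pos (fun _ _ => Finset.sum_pos (fun _ _ => hp _ _ _ _) Finset.univ_nonempty) Finset.univ_nonempty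
    have h10 : 0 < pYZt p y z t := Finset.sum_pos (fun _ _ => hp _ _ _ _) Finset.univ_nonempty
    have hc := hci y z e t
    set q := pYEt p y e t * (pYZt p y z t / pYt p y t * (pT p t * pZ p z / pZt p z t)) with hq
    have hqpos : 0 < q := by positivity
    have hlog := Real.log_le_sub_one_of_pos (div_pos hqpos h0)
    rw [← mul_sub, ← mul_sub, ← Real.log_div (by positivity) (by positivity),
      ← Real.log_div (by positivity) (by positivity)]
    have harg : (pYZt p y z t / pZ p z) / ((pYZ p y z / pZ p z) * (pZt p z t / pZ p z))
        / (pYt p y t / (pY p y * pT p t))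
        / ((pYZE p y z e / pY p y) / ((pYE p y e / pY p y) * (pYZ p y z / pY p y)))
        = q / p y z e t := by
      have hpe : p y z e t = pYEt p y e t / pYE p y e * pYZE p y z e := by
        rw [← hc]; field_simp
      rw [hq, hpe]
      field_simp
    rw [harg]
    calc _ ≤ p y z e t * (q / p y z e t - 1) := by gcongr
      _ = _ := by field_simp
  have hq1 : ∑ y, ∑ z, ∑ e, ∑ t,
      pYEt p y e t * (pYZt p y z t / pYt p y t * (pT p t * pZ p z / pZt p z t)) = 1 := by
    have a1 : ∀ y z, ∑ e, ∑ t,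
        pYEt p y e t * (pYZt p y z t / pYt p y t * (pT p t * pZ p z / pZt p z t))
        = ∑ t, pYZt p y z t * (pT p t * pZ p z / pZt p z t) := by
      intro y z
      rw [Finset.sum_comm]
      refine Finset.sum_congr rfl fun t _ => ?_
      rw [← Finset.sum_mul]
      have b : ∑ e, pYEt p y e t = pYt p y t := by
        unfold pYEt pYt; rw [Finset.sum_comm]
      rw [b]
      rcases isEmpty_or_nonempty E with hE | hE
      · simp [pYt, pYZt]
      · haveI : Nonempty Z := ⟨z⟩
        have h3 : 0 < pYt p y t := Finset.sum_pos (fun _ _ => Finset.sum_pos (fun _ _ => hp _ _ _ _) Finset.univ_nonempty) Finset.univ_nonempty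
        field_simp
    simp_rw [a1]
    rw [Finset.sum_comm]
    have a2 : ∀ z, ∑ y, ∑ t, pYZt p y z t * (pT p t * pZ p z / pZt p z t)
        = pZ p z * ∑ t, pT p t := by
      intro z
      rw [Finset.sum_comm, Finset.mul_sum]
      refine Finset.sum_congr rfl fun t _ => ?_
      rw [← Finset.sum_mul]
      have b : ∑ y, pYZt p y z t = pZt p z t := rfl
      rw [b]
      rcases isEmpty_or_nonempty E with hE | hE
      · simp [pZt, pZ]
      · rcases isEmpty_or_nonempty Y with hY | hY
        · simp [pZt, pZ]
        · have h8 : 0 < pZt p z t := Finset.sum_pos (fun _ _ => Finset.sum_pos (fun _ _ => hp _ _ _ _) Finset.univ_nonempty) Finset.univ_nonempty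
          field_simp
    simp_rw [a2]
    rw [← Finset.sum_mul]
    have c1 : ∑ z, pZ p z = 1 := by
      rw [← hpsum]; unfold pZ; rw [Finset.sum_comm]
    have c2 : ∑ t, pT p t = 1 := by
      rw [← hpsum]
      simp only [pT, Fintype.sum_bool, Finset.sum_add_distrib]
    rw [c1, c2, one_mul]
  have e1 : IytZ p = ∑ y, ∑ z, ∑ e, ∑ t, p y z e t *
      Real.log ((pYZt p y z t / pZ p z) /
        ((pYZ p y z / pZ p z) * (pZt p z t / pZ p z))) := by
    unfold IytZ
    refine Finset.sum_congr rfl fun y _ => Finset.sum_congr rfl fun z _ => ?_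
    rw [Finset.sum_comm]
    refine Finset.sum_congr rfl fun t _ => ?_
    rw [← Finset.sum_mul]; rfl
  have e2 : Iyt p = ∑ y, ∑ z, ∑ e, ∑ t, p y z e t *
      Real.log (pYt p y t / (pY p y * pT p t)) := by
    unfold Iyt
    refine Finset.sum_congr rfl fun y _ => ?_
    simp only [Fintype.sum_bool, Finset.sum_add_distrib, ← Finset.sum_mul]
    rfl
  have e3 : IezY p = ∑ y, ∑ z, ∑ e, ∑ t, p y z e t *
      Real.log ((pYZE p y z e / pY p y) /
        ((pYE p y e / pY p y) * (pYZ p y z / pY p y))) := by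
    unfold IezY
    simp only [← Finset.sum_mul]
    rfl
  have hs := Finset.sum_le_sum fun y (_ : y ∈ Finset.univ) =>
    Finset.sum_le_sum fun z (_ : z ∈ Finset.univ) =>
    Finset.sum_le_sum fun e (_ : e ∈ Finset.univ) =>
    Finset.sum_le_sum fun t (_ : t ∈ Finset.univ) => hmain y z e t
  simp only [Finset.sum_sub_distrib] at hs
  rw [hq1, hpsum, ← e1, ← e2, ← e3] at hs
  linarith

end Stmt12

end
end

section
/- If y and e are independent (I(y;e) = 0), then enforcing separation is equivalent to enforcing both sufficiency and independence: I(e;z|y) = 0 if and only if I(e;y|z) = 0 and I(e;z) = 0. Moreover, in general (without the independence assumption), sufficiency and independence are jointly lower-bounded by the dependence between e and y: I(e;y|z) + I(e;z) ≥ I(e;y); in particular, if I(e;y) > 0 then sufficiency (I(e;y|z) = 0) and independence (I(e;z) = 0) cannot hold simultaneously. -/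
open Finset Real

noncomputable section

namespace Stmt16

variable {E Y Z : Type*} [Fintype E] [Fintype Y] [Fintype Z]

/-- `p(e)`. -/
def pE (p : E → Y → Z → ℝ) (e : E) : ℝ := ∑ y, ∑ z, p e y z
/-- `p(y)`. -/
def pY (p : E → Y → Z → ℝ) (y : Y) : ℝ := ∑ e, ∑ z, p e y z
/-- `p(z)`. -/
def pZ (p : E → Y → Z → ℝ) (z : Z) : ℝ := ∑ e, ∑ y, p e y z
/-- `p(e, y)`. -/
def pEY (p : E → Y → Z → ℝ) (e : E) (y : Y) : ℝ := ∑ z, p e y z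
/-- `p(e, z)`. -/
def pEZ (p : E → Y → Z → ℝ) (e : E) (z : Z) : ℝ := ∑ y, p e y z
/-- `p(y, z)`. -/
def pYZ (p : E → Y → Z → ℝ) (y : Y) (z : Z) : ℝ := ∑ e, p e y z

/-- Separation regularizer `I(e;z|y)`. -/
def IezY (p : E → Y → Z → ℝ) : ℝ :=
  ∑ e, ∑ y, ∑ z, p e y z *
    Real.log ((p e y z / pY p y) / ((pEY p e y / pY p y) * (pYZ p y z / pY p y)))

/-- `I(e;y)`. -/
def IeY (p : E → Y → Z → ℝ) : ℝ :=
  ∑ e, ∑ y, pEY p e y * Real.log (pEY p e y / (pE p e * pY p y))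

/-- Sufficiency regularizer `I(e;y|z)`. -/
def IeyZ (p : E → Y → Z → ℝ) : ℝ :=
  ∑ e, ∑ y, ∑ z, p e y z *
    Real.log ((p e y z / pZ p z) / ((pEZ p e z / pZ p z) * (pYZ p y z / pZ p z)))

/-- Independence regularizer `I(e;z)`. -/
def IeZ (p : E → Y → Z → ℝ) : ℝ :=
  ∑ e, ∑ z, pEZ p e z * Real.log (pEZ p e z / (pE p e * pZ p z))


theorem aux_ineq (a q : ℝ) (ha : 0 ≤ a) (hq : 0 ≤ q) (h : 0 < a → 0 < q) :
    a - q ≤ a * Real.log (a / q) := by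
  rcases ha.eq_or_lt with h0 | h0
  · rw [← h0]; simp; exact hq
  · have hq' := h h0
    have h1 := Real.one_sub_inv_le_log_of_pos (div_pos h0 hq')
    have h2 := mul_le_mul_of_nonneg_left h1 ha
    have h3 : a * (1 - (a / q)⁻¹) = a - q := by field_simp
    linarith

theorem aux_pEZ_pos (p : E → Y → Z → ℝ) (hp : ∀ e y z, 0 ≤ p e y z) (e : E) (y : Y) (z : Z)
    (h : 0 < p e y z) : 0 < pEZ p e z :=
  h.trans_le (Finset.single_le_sum (f := fun y => p e y z) (fun i _ => hp e i z) (Finset.mem_univ y))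

theorem aux_pEY_pos (p : E → Y → Z → ℝ) (hp : ∀ e y z, 0 ≤ p e y z) (e : E) (y : Y) (z : Z)
    (h : 0 < p e y z) : 0 < pEY p e y :=
  h.trans_le (Finset.single_le_sum (f := fun z => p e y z) (fun i _ => hp e y i) (Finset.mem_univ z))

theorem aux_pYZ_pos (p : E → Y → Z → ℝ) (hp : ∀ e y z, 0 ≤ p e y z) (e : E) (y : Y) (z : Z)
    (h : 0 < p e y z) : 0 < pYZ p y z :=
  h.trans_le (Finset.single_le_sum (f := fun e => p e y z) (fun i _ => hp i y z) (Finset.mem_univ e))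

theorem aux_pEY_nn (p : E → Y → Z → ℝ) (hp : ∀ e y z, 0 ≤ p e y z) (e : E) (y : Y) :
    0 ≤ pEY p e y := Finset.sum_nonneg fun i _ => hp e y i

theorem aux_pEZ_nn (p : E → Y → Z → ℝ) (hp : ∀ e y z, 0 ≤ p e y z) (e : E) (z : Z) :
    0 ≤ pEZ p e z := Finset.sum_nonneg fun i _ => hp e i z

theorem aux_pYZ_nn (p : E → Y → Z → ℝ) (hp : ∀ e y z, 0 ≤ p e y z) (y : Y) (z : Z) :
    0 ≤ pYZ p y z := Finset.sum_nonneg fun i _ => hp i y z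

theorem aux_pE_ge (p : E → Y → Z → ℝ) (hp : ∀ e y z, 0 ≤ p e y z) (e : E) (z : Z) :
    pEZ p e z ≤ pE p e := by
  unfold pE pEZ
  rw [Finset.sum_comm]
  exact Finset.single_le_sum (f := fun z => ∑ y, p e y z)
    (fun i _ => aux_pEZ_nn p hp e i) (Finset.mem_univ z)

theorem aux_pY_ge (p : E → Y → Z → ℝ) (hp : ∀ e y z, 0 ≤ p e y z) (e : E) (y : Y) :
    pEY p e y ≤ pY p y :=
  Finset.single_le_sum (f := fun e => ∑ z, p e y z)
    (fun i _ => aux_pEY_nn p hp i y) (Finset.mem_univ e)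

theorem aux_pZ_ge (p : E → Y → Z → ℝ) (hp : ∀ e y z, 0 ≤ p e y z) (e : E) (z : Z) :
    pEZ p e z ≤ pZ p z :=
  Finset.single_le_sum (f := fun e => ∑ y, p e y z)
    (fun i _ => aux_pEZ_nn p hp i z) (Finset.mem_univ e)

theorem aux_IezY_nn (p : E → Y → Z → ℝ) (hp : ∀ e y z, 0 ≤ p e y z) : 0 ≤ IezY p := by
  have hY : ∀ y, 0 ≤ pY p y := fun y =>
    Finset.sum_nonneg fun i _ => aux_pEY_nn p hp i y
  have key : ∀ e y z, p e y z - pEY p e y * pYZ p y z / pY p y ≤ p e y z *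
      Real.log ((p e y z / pY p y) / ((pEY p e y / pY p y) * (pYZ p y z / pY p y))) := by
    intro e y z
    have h := aux_ineq (p e y z) (pEY p e y * pYZ p y z / pY p y) (hp e y z)
      (div_nonneg (mul_nonneg (aux_pEY_nn p hp e y) (aux_pYZ_nn p hp y z)) (hY y))
      (fun h => by
        have h1 := aux_pEY_pos p hp e y z h
        have h2 := aux_pYZ_pos p hp e y z h
        have h3 := h1.trans_le (aux_pY_ge p hp e y)
        positivity)
    have e1 : (p e y z / pY p y) / ((pEY p e y / pY p y) * (pYZ p y z / pY p y))
        = p e y z / (pEY p e y * pYZ p y z / pY p y) := by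
      by_cases h0 : pY p y = 0
      · simp [h0]
      · field_simp
    rw [e1]; exact h
  have s : ∑ e, ∑ y, ∑ z, (p e y z - pEY p e y * pYZ p y z / pY p y) ≤ IezY p :=
    Finset.sum_le_sum fun e _ => Finset.sum_le_sum fun y _ => Finset.sum_le_sum fun z _ => key e y z
  refine le_trans (le_of_eq ?_) s
  symm
  rw [Finset.sum_comm]
  refine Finset.sum_eq_zero fun y _ => ?_
  simp only [Finset.sum_sub_distrib]
  have e2 : ∑ e, ∑ z, pEY p e y * pYZ p y z / pY p y = pY p y * pY p y / pY p y := by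
    have hz : ∑ z, pYZ p y z = pY p y := by unfold pYZ pY; exact Finset.sum_comm
    have he : ∑ e, pEY p e y = pY p y := rfl
    simp only [← Finset.sum_div, ← Finset.mul_sum, ← Finset.sum_mul, hz, he]
  rw [e2]
  change pY p y - _ = 0
  rw [mul_self_div_self, sub_self]

theorem aux_IeyZ_nn (p : E → Y → Z → ℝ) (hp : ∀ e y z, 0 ≤ p e y z) : 0 ≤ IeyZ p := by
  have h := aux_IezY_nn (fun e z y => p e y z) (fun e z y => hp e y z)
  refine h.trans (le_of_eq ?_)
  unfold IezY IeyZ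
  refine Finset.sum_congr rfl fun e _ => ?_
  rw [Finset.sum_comm]
  rfl

theorem aux_IeZ_nn (p : E → Y → Z → ℝ) (hp : ∀ e y z, 0 ≤ p e y z)
    (hpsum : ∑ e, ∑ y, ∑ z, p e y z = 1) : 0 ≤ IeZ p := by
  have key : ∀ e z, pEZ p e z - pE p e * pZ p z ≤
      pEZ p e z * Real.log (pEZ p e z / (pE p e * pZ p z)) := fun e z =>
    aux_ineq _ _ (aux_pEZ_nn p hp e z)
      (mul_nonneg ((aux_pEZ_nn p hp e z).trans (aux_pE_ge p hp e z))
        ((aux_pEZ_nn p hp e z).trans (aux_pZ_ge p hp e z)))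
      (fun h => mul_pos (h.trans_le (aux_pE_ge p hp e z)) (h.trans_le (aux_pZ_ge p hp e z)))
  have s : ∑ e, ∑ z, (pEZ p e z - pE p e * pZ p z) ≤ IeZ p :=
    Finset.sum_le_sum fun e _ => Finset.sum_le_sum fun z _ => key e z
  have h1 : ∑ e, pE p e = 1 := hpsum
  have h2 : ∑ e, ∑ z, pEZ p e z = 1 := by
    rw [← hpsum]
    exact Finset.sum_congr rfl fun e _ => Finset.sum_comm
  have h3 : ∑ z, pZ p z = 1 := by
    rw [← h2]; exact Finset.sum_comm
  simp only [Finset.sum_sub_distrib, ← Finset.mul_sum, ← Finset.sum_mul, h1, h2, h3] at s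
  linarith

theorem aux_chain (p : E → Y → Z → ℝ) (hp : ∀ e y z, 0 ≤ p e y z) :
    IeyZ p + IeZ p = IezY p + IeY p := by
  have hZ : IeZ p = ∑ e, ∑ y, ∑ z, p e y z * Real.log (pEZ p e z / (pE p e * pZ p z)) := by
    unfold IeZ
    refine Finset.sum_congr rfl fun e _ => ?_
    rw [Finset.sum_comm]
    refine Finset.sum_congr rfl fun z _ => ?_
    rw [← Finset.sum_mul]; rfl
  have hY : IeY p = ∑ e, ∑ y, ∑ z, p e y z * Real.log (pEY p e y / (pE p e * pY p y)) := by
    unfold IeY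
    refine Finset.sum_congr rfl fun e _ => Finset.sum_congr rfl fun y _ => ?_
    rw [← Finset.sum_mul]; rfl
  rw [hZ, hY]
  unfold IeyZ IezY
  simp only [← Finset.sum_add_distrib]
  refine Finset.sum_congr rfl fun e _ => Finset.sum_congr rfl fun y _ =>
    Finset.sum_congr rfl fun z _ => ?_
  rcases (hp e y z).eq_or_lt with h | h
  · simp [← h]
  · have a1 := aux_pEZ_pos p hp e y z h
    have a2 := aux_pEY_pos p hp e y z h
    have a3 := aux_pYZ_pos p hp e y z h
    have a4 := a1.trans_le (aux_pE_ge p hp e z)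
    have a5 := a1.trans_le (aux_pZ_ge p hp e z)
    have a6 := a2.trans_le (aux_pY_ge p hp e y)
    rw [← mul_add, ← mul_add, ← Real.log_mul (by positivity) (by positivity),
      ← Real.log_mul (by positivity) (by positivity)]
    congr 2
    field_simp

/-- If `y` and `e` are independent (`I(y;e) = 0`) then separation is equivalent to
sufficiency plus independence: `I(e;z|y) = 0 ↔ (I(e;y|z) = 0 ∧ I(e;z) = 0)`.
In general `I(e;y|z) + I(e;z) ≥ I(e;y)`; in particular if `I(e;y) > 0`, sufficiency and
independence cannot hold simultaneously. -/
theorem separation_iff_sufficiency_and_independence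
    (p : E → Y → Z → ℝ)
    (hp : ∀ e y z, 0 ≤ p e y z)
    (hpsum : ∑ e, ∑ y, ∑ z, p e y z = 1) :
    (IeY p = 0 → (IezY p = 0 ↔ (IeyZ p = 0 ∧ IeZ p = 0))) ∧
    IeyZ p + IeZ p ≥ IeY p ∧
    (0 < IeY p → ¬(IeyZ p = 0 ∧ IeZ p = 0)) := by
  have hc := aux_chain p hp
  have h1 := aux_IezY_nn p hp
  have h2 := aux_IeyZ_nn p hp
  have h3 := aux_IeZ_nn p hp hpsum
  refine ⟨fun h0 => ⟨fun h => ⟨by linarith, by linarith⟩, fun h => ?_⟩, by linarith, fun h0 h => ?_⟩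
  · linarith [h.1, h.2]
  · linarith [h.1, h.2]

end Stmt16

end
end

section
/- (Maximum-likelihood models incur test error under concept shift.) If the model exactly matches the training predictive distribution, q(y|x) = p(y|x,t=1) for all x with P(x|t=1) > 0, then its test error satisfies D_KL(p^{t=0}_{y|x} || q_{y|x}) ≥ (1/(1−α)) · I(y;t|x), where α := min{P(t=0), P(t=1)}; in particular, if the concept shift I(y;t|x) is strictly positive, the test error is strictly positive. -/
open Finset Real

noncomputable section

namespace Stmt19

variable {X Y : Type*} [Fintype X] [Fintype Y]

/-- Marginal probability of the selection `t`: `P(t)`. -/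
def pT (p : X → Y → Bool → ℝ) (t : Bool) : ℝ := ∑ x, ∑ y, p x y t

/-- Marginal probability of `x`: `p(x)`. -/
def pX (p : X → Y → Bool → ℝ) (x : X) : ℝ := ∑ y, ∑ t, p x y t

/-- Joint probability of `(x, t)`: `p(x, t)`. -/
def pXt (p : X → Y → Bool → ℝ) (x : X) (t : Bool) : ℝ := ∑ y, p x y t

/-- Joint probability of `(x, y)`: `p(x, y)`. -/
def pXY (p : X → Y → Bool → ℝ) (x : X) (y : Y) : ℝ := ∑ t, p x y t

/-- `D_KL(p^{t=i}_{y|x} ‖ q_{y|x}) = Σ_{x,y} p(x,y|t=i) log (p(y|x,t=i) / q(y|x))`. -/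
def condErr (p : X → Y → Bool → ℝ) (q : X → Y → ℝ) (t : Bool) : ℝ :=
  ∑ x, ∑ y, (p x y t / pT p t) * Real.log ((p x y t / pXt p x t) / q x y)

/-- Concept shift `I(y;t|x)`. -/
def conceptShift (p : X → Y → Bool → ℝ) : ℝ :=
  ∑ x, ∑ y, ∑ t, p x y t *
    Real.log ((p x y t / pX p x) / ((pXY p x y / pX p x) * (pXt p x t / pX p x)))

theorem gibbs_aux {Y : Type*} [Fintype Y] (u v : Y → ℝ) (hu : ∀ y, 0 < u y)
    (hv : ∀ y, 0 < v y) (h : ∑ y, v y = ∑ y, u y) :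
    0 ≤ ∑ y, u y * Real.log (u y / v y) := by
  have h1 : ∑ y, (u y - v y) ≤ ∑ y, u y * Real.log (u y / v y) := by
    apply Finset.sum_le_sum
    intro y _
    have h2 := Real.one_sub_inv_le_log_of_pos (div_pos (hu y) (hv y))
    have h3 := mul_le_mul_of_nonneg_left h2 (hu y).le
    have h4 : u y * (1 - (u y / v y)⁻¹) = u y - v y := by
      have := (hu y).ne'
      field_simp
    linarith
  rw [Finset.sum_sub_distrib, h, sub_self] at h1
  exact h1

/-- Maximum-likelihood models incur test error under concept shift: if the model exactly
matches the training predictive distribution, `q(y|x) = p(y|x,t=1)`, then its test error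
satisfies `D_KL(p^{t=0}_{y|x} ‖ q_{y|x}) ≥ (1/(1−α)) I(y;t|x)` with
`α = min {P(t=0), P(t=1)}`; in particular the test error is strictly positive whenever the
concept shift is. -/
theorem ml_model_test_error
    (p : X → Y → Bool → ℝ) (q : X → Y → ℝ)
    (hp : ∀ x y t, 0 < p x y t)
    (hpsum : ∑ x, ∑ y, ∑ t, p x y t = 1)
    (ht0 : 0 < pT p true) (ht1 : pT p true < 1)
    (hq : ∀ x y, 0 < pXt p x true → q x y = p x y true / pXt p x true) :
    condErr p q false ≥ (1 / (1 - min (pT p false) (pT p true))) * conceptShift p ∧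
    (0 < conceptShift p → 0 < condErr p q false) := by
  have hY : Nonempty Y := by
    by_contra hne
    rw [not_nonempty_iff] at hne
    simp at hpsum
  have hXt : ∀ x t, 0 < pXt p x t := fun x t =>
    Finset.sum_pos (fun y _ => hp x y t) Finset.univ_nonempty
  have hXY : ∀ x y, pXY p x y = p x y true + p x y false := fun x y => by
    simp [pXY]
  have hX : ∀ x, pX p x = pXt p x true + pXt p x false := fun x => by
    simp [pX, pXt, Finset.sum_add_distrib]
  have hT : pT p true + pT p false = 1 := by
    rw [← hpsum]
    simp [pT, Finset.sum_add_distrib]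
  have hF : 0 < pT p false := by linarith
  have hXYpos : ∀ x y, 0 < pXY p x y := fun x y => by
    rw [hXY]; exact add_pos (hp _ _ _) (hp _ _ _)
  have hXpos : ∀ x, 0 < pX p x := fun x => by
    rw [hX]; exact add_pos (hXt _ _) (hXt _ _)
  have hsXY : ∀ x, ∑ y, pXY p x y = pX p x := fun x => rfl
  -- the unnormalised error
  set E : ℝ := ∑ x, ∑ y, p x y false *
    Real.log (p x y false / (pXt p x false * (p x y true / pXt p x true))) with hE
  have hEc : condErr p q false = E / pT p false := by
    rw [hE, condErr, Finset.sum_div]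
    refine Finset.sum_congr rfl fun x _ => ?_
    rw [Finset.sum_div]
    refine Finset.sum_congr rfl fun y _ => ?_
    rw [hq x y (hXt x true), div_div (p x y false)]
    ring
  have hE0 : 0 ≤ E := by
    refine Finset.sum_nonneg fun x _ => ?_
    refine gibbs_aux (fun y => p x y false)
      (fun y => pXt p x false * (p x y true / pXt p x true)) (fun y => hp _ _ _)
      (fun y => mul_pos (hXt _ _) (div_pos (hp _ _ _) (hXt _ _))) ?_
    rw [← Finset.mul_sum, ← Finset.sum_div]
    change pXt p x false * (pXt p x true / pXt p x true) = pXt p x false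
    rw [div_self (hXt x true).ne', mul_one]
  have hIE : conceptShift p ≤ E := by
    rw [hE, conceptShift]
    refine Finset.sum_le_sum fun x _ => ?_
    have hg := gibbs_aux (fun y => pXY p x y)
      (fun y => pX p x * (p x y true / pXt p x true)) (fun y => hXYpos _ _)
      (fun y => mul_pos (hXpos _) (div_pos (hp _ _ _) (hXt _ _))) (by
        rw [← Finset.mul_sum, ← Finset.sum_div]
        change pX p x * (pXt p x true / pXt p x true) = pX p x
        rw [div_self (hXt x true).ne', mul_one])
    rw [← sub_nonneg, ← Finset.sum_sub_distrib]
    refine hg.trans (le_of_eq (Finset.sum_congr rfl fun y _ => ?_))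
    have a1 := (hp x y true).ne'
    have a2 := (hp x y false).ne'
    have a3 := (hXt x true).ne'
    have a4 := (hXt x false).ne'
    have a5 := (hXYpos x y).ne'
    have a6 := (hXpos x).ne'
    rw [Fintype.sum_bool]
    have l1 : Real.log (pXY p x y / (pX p x * (p x y true / pXt p x true))) =
        Real.log (pXY p x y) - (Real.log (pX p x) +
          (Real.log (p x y true) - Real.log (pXt p x true))) := by
      rw [Real.log_div a5 (by positivity), Real.log_mul a6 (by positivity), Real.log_div a1 a3]
    have l2 : Real.log (p x y false / (pXt p x false * (p x y true / pXt p x true))) =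
        Real.log (p x y false) - (Real.log (pXt p x false) +
          (Real.log (p x y true) - Real.log (pXt p x true))) := by
      rw [Real.log_div a2 (by positivity), Real.log_mul a4 (by positivity), Real.log_div a1 a3]
    have l3 : ∀ t, Real.log ((p x y t / pX p x) / ((pXY p x y / pX p x) * (pXt p x t / pX p x)))
        = Real.log (p x y t) + Real.log (pX p x) - Real.log (pXY p x y)
          - Real.log (pXt p x t) := by
      intro t
      have b1 := (hp x y t).ne'
      have b2 := (hXt x t).ne'
      rw [Real.log_div (by positivity) (by positivity), Real.log_mul (by positivity) (by positivity),
        Real.log_div b1 a6, Real.log_div a5 a6, Real.log_div b2 a6]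
      ring
    simp only [l1, l2, l3]
    have hxy := hXY x y
    linear_combination (Real.log (pXY p x y) - (Real.log (pX p x) +
          (Real.log (p x y true) - Real.log (pXt p x true)))) * hxy
  have hmin : min (pT p false) (pT p true) ≤ pT p true := min_le_right _ _
  have hpos : 0 < 1 - min (pT p false) (pT p true) := by linarith
  have hle : pT p false ≤ 1 - min (pT p false) (pT p true) := by linarith
  have main : condErr p q false ≥
      (1 / (1 - min (pT p false) (pT p true))) * conceptShift p := by
    rw [hEc, ge_iff_le, one_div_mul_eq_div]
    exact (div_le_div_of_nonneg_right hIE hpos.le).trans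
      (div_le_div_of_nonneg_left hE0 hF hle)
  exact ⟨main, fun h => lt_of_lt_of_le (mul_pos (one_div_pos.mpr hpos) h) main⟩

end Stmt19

end
end
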